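/- Let q ≥ 1 and n, d₁, …, d_q be positive integers, β > 0, σ₂ > q − 1, and (τ, s) real numbers with τ < 1, s < 1, τ + s > 0. For each j = 1, …, q let B_j be a real n × d_j matrix of full column rank. Then for all vectors y_j ∈ ℝ^{d_j} (j = 1, …, q) and λ ∈ ℝ^n, not all zero, one has (σ₂ + 1 − s)β·∑_{j=1}^q ‖B_j y_j‖² − sβ·∑_{j=1}^q ∑_{l≠j} ⟨B_j y_j, B_l y_l⟩ + 2(s − 1)·∑_{j=1}^q ⟨B_j y_j, λ⟩ + ((2 − τ − s)/β)·‖λ‖² > 0. -/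

import Mathlib

open Matrix

lemma sum_dotProduct_sum_le_card_mul {ι κ : Type*} [Fintype ι] [Fintype κ] (x : ι → κ → ℝ) :
    (∑ j, x j) ⬝ᵥ (∑ j, x j) ≤ (Fintype.card ι : ℝ) * ∑ j, x j ⬝ᵥ x j := by
  simp only [dotProduct, Finset.sum_apply]
  rw [Finset.sum_comm, Finset.mul_sum]
  refine Finset.sum_le_sum fun i _ => ?_
  have h := sq_sum_le_card_mul_sum_sq (s := Finset.univ) (f := fun j => x j i)
  simpa only [sq, Finset.card_univ] using h

lemma sum_sum_ne_dotProduct {ι κ : Type*} [Fintype ι] [DecidableEq ι] [Fintype κ]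
    (x : ι → κ → ℝ) :
    ∑ j, ∑ l ∈ Finset.univ.filter (fun l => l ≠ j), x j ⬝ᵥ x l =
      (∑ j, x j) ⬝ᵥ (∑ j, x j) - ∑ j, x j ⬝ᵥ x j := by
  rw [sum_dotProduct, ← Finset.sum_sub_distrib]
  refine Finset.sum_congr rfl fun j _ => ?_
  rw [dotProduct_sum, Finset.filter_ne', ← Finset.add_sum_erase _ _ (Finset.mem_univ j)]
  ring

lemma dotProduct_self_nonneg_real {κ : Type*} [Fintype κ] (v : κ → ℝ) : 0 ≤ v ⬝ᵥ v :=
  Finset.sum_nonneg fun i _ => mul_self_nonneg (v i)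

lemma dotProduct_self_pos_real {κ : Type*} [Fintype κ] {v : κ → ℝ} (hv : v ≠ 0) : 0 < v ⬝ᵥ v :=
  lt_of_le_of_ne (dotProduct_self_nonneg_real v) fun h => hv (dotProduct_self_eq_zero.1 h.symm)

theorem stmt_4 (q n : ℕ) (hq : 1 ≤ q) (hn : 0 < n)
    (d : Fin q → ℕ) (hd : ∀ j, 0 < d j)
    (β σ₂ τ s : ℝ) (hβ : 0 < β) (hσ₂ : σ₂ > (q : ℝ) - 1)
    (hτ : τ < 1) (hs : s < 1) (hτs : τ + s > 0)
    (B : (j : Fin q) → Matrix (Fin n) (Fin (d j)) ℝ)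
    (hB : ∀ j, Function.Injective (B j).mulVec)
    (y : (j : Fin q) → (Fin (d j) → ℝ)) (lam : Fin n → ℝ)
    (hy : (∃ j, y j ≠ 0) ∨ lam ≠ 0) :
    (σ₂ + 1 - s) * β * ∑ j, (B j).mulVec (y j) ⬝ᵥ (B j).mulVec (y j) -
      s * β * ∑ j, ∑ l ∈ Finset.univ.filter (fun l => l ≠ j),
        (B j).mulVec (y j) ⬝ᵥ (B l).mulVec (y l) +
      2 * (s - 1) * ∑ j, (B j).mulVec (y j) ⬝ᵥ lam +
      ((2 - τ - s) / β) * (lam ⬝ᵥ lam) > 0 := by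
  have hx : (∃ j, (B j).mulVec (y j) ≠ 0) ∨ lam ≠ 0 :=
    hy.imp_left fun ⟨j, hj⟩ => ⟨j, fun h => hj (hB j (h.trans (mulVec_zero _).symm))⟩
  rw [sum_sum_ne_dotProduct (fun j => (B j).mulVec (y j)), ← sum_dotProduct]
  set x : Fin q → Fin n → ℝ := fun j => (B j).mulVec (y j) with hxdef
  have hqS := sum_dotProduct_sum_le_card_mul x
  rw [Fintype.card_fin] at hqS
  have hS : 0 ≤ ∑ j, x j ⬝ᵥ x j := Finset.sum_nonneg fun j _ => dotProduct_self_nonneg_real _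
  have hL := dotProduct_self_nonneg_real lam
  have hpos : 0 < ∑ j, x j ⬝ᵥ x j ∨ 0 < lam ⬝ᵥ lam := by
    refine hx.imp (fun ⟨j, hj⟩ => ?_) dotProduct_self_pos_real
    exact Finset.sum_pos' (fun j _ => dotProduct_self_nonneg_real _)
      ⟨j, Finset.mem_univ j, dotProduct_self_pos_real hj⟩
  have hW := dotProduct_self_nonneg_real (β • (∑ j, x j) - lam)
  simp only [sub_dotProduct, dotProduct_sub, smul_dotProduct, dotProduct_smul, smul_eq_mul,
    dotProduct_comm lam (∑ j, x j)] at hW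
  change (σ₂ + 1 - s) * β * (∑ j, x j ⬝ᵥ x j) -
    s * β * ((∑ j, x j) ⬝ᵥ (∑ j, x j) - ∑ j, x j ⬝ᵥ x j) +
    2 * (s - 1) * ((∑ j, x j) ⬝ᵥ lam) + ((2 - τ - s) / β) * (lam ⬝ᵥ lam) > 0
  generalize (∑ j, x j ⬝ᵥ x j) = S at *
  generalize (∑ j, x j) ⬝ᵥ (∑ j, x j) = T at *
  generalize (∑ j, x j) ⬝ᵥ lam = C at *
  generalize lam ⬝ᵥ lam = L at *
  have key : (σ₂ + 1 - s) * β * S - s * β * (T - S) + 2 * (s - 1) * C + ((2 - τ - s) / β) * L =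
      (σ₂ + 1 - q) * S * β + (q * S - T) * β +
      (1 - s) / β * (β * (β * T) - β * C - (β * C - L)) + (1 - τ) / β * L := by
    field_simp
    ring
  rw [key]
  have h1 : 0 < σ₂ + 1 - q := by linarith
  have h2 : 0 < (1 - s) / β := div_pos (by linarith) hβ
  have h3 : 0 < (1 - τ) / β := div_pos (by linarith) hβ
  have a1 : 0 ≤ (σ₂ + 1 - q) * S * β := by positivity
  have a2 : 0 ≤ (q * S - T) * β := mul_nonneg (by linarith) hβ.le
  have a3 : 0 ≤ (1 - s) / β * (β * (β * T) - β * C - (β * C - L)) :=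
    mul_nonneg h2.le (by linarith)
  have a4 : 0 ≤ (1 - τ) / β * L := by positivity
  rcases hpos with hpos | hpos
  · have : 0 < (σ₂ + 1 - q) * S * β := by positivity
    linarith
  · have : 0 < (1 - τ) / β * L := by positivity
    linarith
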